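/- arXiv:2002.07444 — 3 statements merged into one kernel-verified Lean document; each statement's English description precedes it below -/
import Mathlib

section
/- For every k ≥ 2 there is a constant c such that the following holds for all n ≥ 1 and d ∈ ℕ. Let f : (Fin n → Bool) → Bool with f ∈ R_k, and let C ∈ ThrLit(k,n,d) satisfy C ≤ f. Then there exists a k-party tree protocol of depth at most c·(d+1) computing the R_k-communication game for f. (Paper's Proposition 'R_k_to_protocols'.) -/
/-- Number of ones of a Boolean vector. -/
def numOnes {N : ℕ} (x : Fin N → Bool) : ℕ :=
  (Finset.univ.filter fun i => x i = true).card

/-- THR^b_a : true iff the input has at least `a` ones. -/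
def THR {b : ℕ} (a : ℕ) (x : Fin b → Bool) : Bool :=
  decide (a ≤ numOnes x)

/-- The gate THR^{k+1}_2 : true iff at least 2 of the k+1 input bits are true. -/
def THRgate (k : ℕ) (v : Fin (k + 1) → Bool) : Bool :=
  decide (2 ≤ numOnes v)

/-- `Thr k n d` : Boolean functions on n variables computable by depth-d
formulas consisting only of THR^{k+1}_2 gates and variables. -/
def Thr (k n : ℕ) : ℕ → Set ((Fin n → Bool) → Bool)
  | 0 => { f | ∃ i : Fin n, f = fun x => x i }
  | d + 1 => Thr k n d ∪
      { f | ∃ g : Fin (k + 1) → ((Fin n → Bool) → Bool),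
          (∀ j, g j ∈ Thr k n d) ∧ f = fun x => THRgate k (fun j => g j x) }

/-- A k-party number-in-hand tree protocol with inputs from X and outputs in Y. -/
inductive Protocol (X Y : Type) (k : ℕ) : Type
  | leaf (y : Y)
  | node (i : Fin k) (φ : X → Bool) (π₀ π₁ : Protocol X Y k)

/-- Depth of a protocol tree (a leaf has depth 0). -/
def Protocol.depth {X Y : Type} {k : ℕ} : Protocol X Y k → ℕ
  | .leaf _ => 0
  | .node _ _ π₀ π₁ => max π₀.depth π₁.depth + 1

/-- Output of a protocol on an input tuple. -/
def Protocol.out {X Y : Type} {k : ℕ} : Protocol X Y k → (Fin k → X) → Y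
  | .leaf y, _ => y
  | .node i φ π₀ π₁, x => if φ (x i) then π₁.out x else π₀.out x

/-- `f ∈ R_k`: on any k vectors on which f is false there is a coordinate where
all k vectors agree. -/
def RkMem (k n : ℕ) (f : (Fin n → Bool) → Bool) : Prop :=
  ∀ x : Fin k → Fin n → Bool, (∀ i, f (x i) = false) →
    ∃ j, ∃ b : Bool, ∀ i, x i j = b

/-- `C ≤ f`: C is false wherever f is false. -/
def circLE {n : ℕ} (C f : (Fin n → Bool) → Bool) : Prop :=
  ∀ x, f x = false → C x = false

/-- `ThrLit k n d` : Boolean functions on n variables computable by depth-d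
formulas consisting only of THR^{k+1}_2 gates and literals. -/
def ThrLit (k n : ℕ) : ℕ → Set ((Fin n → Bool) → Bool)
  | 0 => { f | ∃ i : Fin n, f = (fun x => x i) ∨ f = (fun x => !(x i)) }
  | d + 1 => ThrLit k n d ∪
      { f | ∃ g : Fin (k + 1) → ((Fin n → Bool) → Bool),
          (∀ j, g j ∈ ThrLit k n d) ∧ f = fun x => THRgate k (fun j => g j x) }

/-- The protocol π computes the R_k-communication game for f. -/
def ComputesRGame (k n : ℕ) (f : (Fin n → Bool) → Bool)
    (π : Protocol (Fin n → Bool) (Fin n × Bool) k) : Prop :=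
  ∀ x : Fin k → Fin n → Bool, (∀ i, f (x i) = false) →
    ∀ i, x i (π.out x).1 = (π.out x).2

theorem test_protocol {X Y : Type} {k : ℕ} (g : X → Bool) (π ρ : Protocol X Y k) (D : ℕ)
    (h1 : π.depth ≤ D) (h2 : ρ.depth ≤ D) (L : List (Fin k)) :
    ∃ σ : Protocol X Y k, σ.depth ≤ D + L.length ∧
      ∀ x, ((∀ i ∈ L, g (x i) = false) → σ.out x = π.out x) ∧
        ((¬ ∀ i ∈ L, g (x i) = false) → σ.out x = ρ.out x) := by
  induction L with
  | nil => exact ⟨π, by simpa using h1, fun x => by simp⟩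
  | cons a L ih =>
    obtain ⟨σ, hd, ho⟩ := ih
    refine ⟨.node a g σ ρ, ?_, ?_⟩
    · simp only [Protocol.depth, List.length_cons]
      omega
    · intro x
      have h := ho x
      by_cases ha : g (x a) = true
      · simp [Protocol.out, ha]
      · simp only [Bool.not_eq_true] at ha
        simpa [Protocol.out, ha] using h

theorem search_protocol {X Y J : Type} {k : ℕ} (ok : (Fin k → X) → Y → Prop)
    (g : J → X → Bool) (π : J → Protocol X Y k) (D : ℕ)
    (h1 : ∀ j, (π j).depth ≤ D)
    (h2 : ∀ j x, (∀ i, g j (x i) = false) → ok x ((π j).out x)) (j₀ : J) (L : List J) :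
    ∃ σ : Protocol X Y k, σ.depth ≤ D + k * L.length ∧
      ∀ x, (∃ j ∈ L, ∀ i, g j (x i) = false) → ok x (σ.out x) := by
  induction L with
  | nil => exact ⟨π j₀, by simpa using h1 j₀, fun x => by simp⟩
  | cons a L ih =>
    obtain ⟨ρ, hd, ho⟩ := ih
    obtain ⟨σ, hσ, hs⟩ := test_protocol (g a) (π a) ρ (D + k * L.length)
      (le_trans (h1 a) (by omega)) hd (List.finRange k)
    refine ⟨σ, ?_, ?_⟩
    · simp only [List.length_finRange] at hσ
      simp only [List.length_cons, mul_add, mul_one]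
      omega
    · rintro x ⟨j, hj, hx⟩
      by_cases ha : ∀ i, g a (x i) = false
      · rw [(hs x).1 (fun i _ => ha i)]
        exact h2 a x ha
      · rw [(hs x).2 (fun h => ha fun i => h i (List.mem_finRange i))]
        apply ho
        rcases List.mem_cons.1 hj with rfl | hj
        · exact absurd hx ha
        · exact ⟨j, hj, hx⟩

/-- Pigeonhole: if every one of `k` parties sees at most one true child among `k+1`,
some child is false for all parties. -/
theorem exists_common_false {k : ℕ} (v : Fin k → Fin (k + 1) → Bool)
    (h : ∀ i, THRgate k (v i) = false) : ∃ j, ∀ i, v i j = false := by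
  by_contra! hc
  choose p hp using hc
  obtain ⟨a, b, hab, he⟩ := Fintype.exists_ne_map_eq_of_card_lt p (by simp)
  have h1 := h (p a)
  unfold THRgate numOnes at h1
  have h2 : 1 < (Finset.univ.filter fun i => v (p a) i = true).card := by
    rw [Finset.one_lt_card]
    refine ⟨a, ?_, b, ?_, hab⟩
    · simpa using hp a
    · rw [he]
      simpa using hp b
  exact of_decide_eq_false h1 h2

theorem thrLit_protocol (k n d : ℕ) : ∀ C ∈ ThrLit k n d,
    ∃ π : Protocol (Fin n → Bool) (Fin n × Bool) k, π.depth ≤ (k * (k + 1)) * d ∧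
      ∀ x : Fin k → Fin n → Bool, (∀ i, C (x i) = false) →
        ∀ i, x i (π.out x).1 = (π.out x).2 := by
  induction d with
  | zero =>
    rintro C ⟨j, rfl | rfl⟩
    · exact ⟨.leaf (j, false), by simp [Protocol.depth], fun x h i => h i⟩
    · exact ⟨.leaf (j, true), by simp [Protocol.depth],
        fun x h i => by simpa [Protocol.out] using h i⟩
  | succ d ih =>
    rintro C (hC | ⟨g, hg, rfl⟩)
    · obtain ⟨π, hd, h⟩ := ih C hC
      exact ⟨π, hd.trans (Nat.mul_le_mul_left _ (Nat.le_succ d)), h⟩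
    · choose π hd hπ using fun j => ih (g j) (hg j)
      obtain ⟨σ, hσ, hs⟩ := search_protocol
        (fun (x : Fin k → Fin n → Bool) (y : Fin n × Bool) => ∀ i, x i y.1 = y.2)
        g π _ hd hπ 0 (List.finRange (k + 1))
      refine ⟨σ, ?_, ?_⟩
      · simp only [List.length_finRange] at hσ
        rw [Nat.mul_succ]
        exact hσ
      · intro x hx
        apply hs
        obtain ⟨j, hj⟩ := exists_common_false (fun i j => g j (x i)) hx
        exact ⟨j, List.mem_finRange j, hj⟩

/-- circuits of THR^{k+1}_2 gates and literals lower-bounding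
f ∈ R_k yield protocols for the R_k-game with constant-factor depth blowup. -/
theorem Rk_to_protocols (k : ℕ) (hk : 2 ≤ k) :
    ∃ c : ℕ, ∀ n d : ℕ, 1 ≤ n → ∀ f : (Fin n → Bool) → Bool, RkMem k n f →
      ∀ C ∈ ThrLit k n d, circLE C f →
        ∃ π : Protocol (Fin n → Bool) (Fin n × Bool) k,
          π.depth ≤ c * (d + 1) ∧ ComputesRGame k n f π := by
  refine ⟨k * (k + 1), fun n d _ f _ C hC hle => ?_⟩
  obtain ⟨π, hd, h⟩ := thrLit_protocol k n d C hC
  exact ⟨π, hd.trans (Nat.mul_le_mul_left _ (Nat.le_succ d)),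
    fun x hx => h x fun i => hle _ (hx i)⟩
end

section
/- For every k ≥ 2 there is a constant c such that the following holds for all n ≥ 1 and d ∈ ℕ. Let f : (Fin n → Bool) → Bool with f ∈ Q_k. If there exists a k-party tree protocol of depth at most d computing the Q_k-communication game for f, then there exists C ∈ Thr(k, n, c·(d+1)) with C ≤ f. (Paper's Proposition 'Q_k_to_circuits': protocols for the Q_k-game can be converted into circuits of THR^{k+1}_2 gates and variables with only a constant-factor depth blowup.) -/
/-- `f ∈ Q_k`: any k vectors on which f is false have a common zero coordinate. -/
def QkMem (k n : ℕ) (f : (Fin n → Bool) → Bool) : Prop :=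
  ∀ x : Fin k → Fin n → Bool, (∀ i, f (x i) = false) →
    ∃ j, ∀ i, x i j = false

/-- The protocol π computes the Q_k-communication game for f. -/
def ComputesQGame (k n : ℕ) (f : (Fin n → Bool) → Bool)
    (π : Protocol (Fin n → Bool) (Fin n) k) : Prop :=
  ∀ x : Fin k → Fin n → Bool, (∀ i, f (x i) = false) →
    ∀ i, x i (π.out x) = false

theorem THRgate_false_iff (k : ℕ) (v : Fin (k + 1) → Bool) :
    THRgate k v = false ↔ ∀ a b, v a = true → v b = true → a = b := by
  unfold THRgate numOnes
  rw [decide_eq_false_iff_not, not_le, Nat.lt_succ_iff, Finset.card_le_one]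
  simp only [Finset.mem_filter, Finset.mem_univ, true_and]
  constructor
  · intro h a b ha hb
    exact h a ha b hb
  · intro h a ha b hb
    exact h a b ha hb

theorem Thr_mono (k n : ℕ) {d e : ℕ} (h : d ≤ e) : Thr k n d ⊆ Thr k n e := by
  induction h with
  | refl => exact subset_rfl
  | step _ ih => exact ih.trans (fun f hf => Or.inl hf)

theorem Thr_var (k n d : ℕ) (i : Fin n) : (fun x : Fin n → Bool => x i) ∈ Thr k n d :=
  Thr_mono k n (Nat.zero_le d) ⟨i, rfl⟩

/-- The formula built from a protocol and variables `z`: it is zero on the inputs of party `i`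
as soon as all `z l` with `l ≠ i` are zero. -/
theorem protocol_formula (k n : ℕ) (z : Fin k → Fin n)
    (π : Protocol (Fin n → Bool) (Fin n) k) :
    ∀ S : Fin k → Set (Fin n → Bool), (∀ i, (S i).Nonempty) →
      (∀ x : Fin k → Fin n → Bool, (∀ i, x i ∈ S i) → ∀ i, x i (π.out x) = false) →
      ∃ C ∈ Thr k n π.depth, ∀ i, ∀ x ∈ S i, (∀ l, l ≠ i → x (z l) = false) → C x = false := by
  induction π with
  | leaf y =>
    intro S hne hS
    refine ⟨fun x => x y, ⟨y, rfl⟩, ?_⟩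
    intro i x hx _
    choose w hw using hne
    have := hS (Function.update w i x) (by
      intro l
      by_cases hl : l = i
      · subst hl; simpa using hx
      · simpa [hl] using hw l) i
    simpa [Protocol.out] using this
  | node p φ π₀ π₁ ih₀ ih₁ =>
    intro S hne hS
    have hd0 : π₀.depth ≤ max π₀.depth π₁.depth := le_max_left _ _
    have hd1 : π₁.depth ≤ max π₀.depth π₁.depth := le_max_right _ _
    have key : ∀ b : Bool, (S p ∩ {x | φ x = b}).Nonempty →
        ∃ C ∈ Thr k n (max π₀.depth π₁.depth), ∀ i, ∀ x ∈ S i, (i = p → φ x = b) →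
          (∀ l, l ≠ i → x (z l) = false) → C x = false := by
      intro b hb
      have hS'ne : ∀ i, (Function.update S p (S p ∩ {x | φ x = b}) i).Nonempty := by
        intro i
        by_cases hi : i = p
        · subst hi; simpa using hb
        · simpa [hi] using hne i
      have hmem : ∀ x : Fin k → Fin n → Bool,
          (∀ i, x i ∈ Function.update S p (S p ∩ {x | φ x = b}) i) →
          (∀ i, x i ∈ S i) ∧ φ (x p) = b := by
        intro x hx
        have hp := hx p
        simp only [Function.update_self] at hp
        refine ⟨fun i => ?_, hp.2⟩
        by_cases hi : i = p
        · subst hi; exact hp.1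
        · have := hx i
          simpa [hi] using this
      have fin : ∀ C : (Fin n → Bool) → Bool,
          (∀ i, ∀ x ∈ Function.update S p (S p ∩ {x | φ x = b}) i,
            (∀ l, l ≠ i → x (z l) = false) → C x = false) →
          ∀ i, ∀ x ∈ S i, (i = p → φ x = b) →
            (∀ l, l ≠ i → x (z l) = false) → C x = false := by
        intro C hC i x hx hφ hz
        refine hC i x ?_ hz
        by_cases hi : i = p
        · subst hi
          simp only [Function.update_self]
          exact ⟨hx, hφ rfl⟩
        · simpa [hi] using hx
      cases b with
      | false =>
        obtain ⟨C, hC, hC'⟩ := ih₀ _ hS'ne (by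
          intro x hx i
          obtain ⟨h1, h2⟩ := hmem x hx
          have := hS x h1 i
          simpa [Protocol.out, h2] using this)
        exact ⟨C, Thr_mono k n hd0 hC, fin C hC'⟩
      | true =>
        obtain ⟨C, hC, hC'⟩ := ih₁ _ hS'ne (by
          intro x hx i
          obtain ⟨h1, h2⟩ := hmem x hx
          have := hS x h1 i
          simpa [Protocol.out, h2] using this)
        exact ⟨C, Thr_mono k n hd1 hC, fin C hC'⟩
    have triv : ∀ b : Bool, ¬ (S p ∩ {x | φ x = !b}).Nonempty → ∀ x ∈ S p, φ x = b := by
      intro b hb x hx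
      by_contra hne'
      exact hb ⟨x, hx, by
        show φ x = !b
        cases h : φ x <;> cases b <;> simp_all⟩
    by_cases h0 : (S p ∩ {x | φ x = false}).Nonempty
    · by_cases h1 : (S p ∩ {x | φ x = true}).Nonempty
      · obtain ⟨C0, hC0, hC0'⟩ := key false h0
        obtain ⟨C1, hC1, hC1'⟩ := key true h1
        let g : Fin (k + 1) → ((Fin n → Bool) → Bool) :=
          Fin.cons C1 (fun l => if l = p then C0 else fun x => x (z l))
        refine ⟨fun x => THRgate k (fun j => g j x), Or.inr ⟨g, ?_, rfl⟩, ?_⟩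
        · intro j
          refine Fin.cases ?_ (fun l => ?_) j
          · simpa [g] using hC1
          · by_cases hl : l = p
            · simpa [g, hl] using hC0
            · simpa [g, hl] using Thr_var k n _ (z l)
        · intro i x hx hz
          rw [THRgate_false_iff]
          have g0 : g 0 x = C1 x := rfl
          have gp : g p.succ x = C0 x := by simp [g]
          have gl : ∀ l, l ≠ p → g (Fin.succ l) x = x (z l) := by
            intro l hl; simp [g, hl]
          by_cases hi : i = p
          · subst hi
            have hzl : ∀ l, l ≠ i → g (Fin.succ l) x = false := fun l hl => by
              rw [gl l hl, hz l hl]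
            cases hφ : φ x with
            | false =>
              have hc := hC0' i x hx (fun _ => hφ) hz
              have all0 : ∀ j, g j x = true → j = 0 := by
                intro j
                refine Fin.cases (fun _ => rfl) (fun l hl => ?_) j
                exfalso
                by_cases hli : l = i
                · subst hli; rw [gp, hc] at hl; cases hl
                · rw [hzl l hli] at hl; cases hl
              intro a b ha hb
              rw [all0 a ha, all0 b hb]
            | true =>
              have hc := hC1' i x hx (fun _ => hφ) hz
              have all0 : ∀ j, g j x = true → j = i.succ := by
                intro j
                refine Fin.cases (fun hl => ?_) (fun l hl => ?_) j
                · rw [g0, hc] at hl; cases hl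
                by_cases hli : l = i
                · rw [hli]
                · rw [hzl l hli] at hl; cases hl
              intro a b ha hb
              rw [all0 a ha, all0 b hb]
          · have hc0 := hC0' i x hx (fun h => absurd h hi) hz
            have hc1 := hC1' i x hx (fun h => absurd h hi) hz
            have all0 : ∀ j, g j x = true → j = i.succ := by
              intro j
              refine Fin.cases (fun hl => ?_) (fun l hl => ?_) j
              · rw [g0, hc1] at hl; cases hl
              by_cases hlp : l = p
              · subst hlp; rw [gp, hc0] at hl; cases hl
              · by_cases hli : l = i
                · rw [hli]
                · rw [gl l hlp, hz l hli] at hl; cases hl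
            intro a b ha hb
            rw [all0 a ha, all0 b hb]
      · obtain ⟨C0, hC0, hC0'⟩ := key false h0
        refine ⟨C0, Or.inl hC0, fun i x hx hz => hC0' i x hx ?_ hz⟩
        intro hi; subst hi
        exact triv false h1 x hx
    · have hall := triv true h0
      obtain ⟨C1, hC1, hC1'⟩ := key true (by
        obtain ⟨x, hx⟩ := hne p
        exact ⟨x, hx, hall x hx⟩)
      refine ⟨C1, Or.inl hC1, fun i x hx hz => hC1' i x hx ?_ hz⟩
      intro hi; subst hi
      exact hall x hx

/-- Conversion of formulas over the gate with `m+1` inputs into formulas over the gate with `m+2`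
inputs, given the conversion of single gates on variables. -/
theorem transform (m n e : ℕ) (X : Set (Fin n → Bool))
    (hX : ∀ j : Fin (m + 1) → Fin n, ∃ C ∈ Thr (m + 1) n e, ∀ x ∈ X,
      THRgate m (fun i => x (j i)) = false → C x = false) :
    ∀ D, ∀ T ∈ Thr m n D, ∃ C ∈ Thr (m + 1) n (e + (m + 1) * D), ∀ x ∈ X,
      T x = false → C x = false := by
  intro D
  induction D with
  | zero =>
    rintro T ⟨i, rfl⟩
    exact ⟨_, Thr_var _ _ _ i, fun x _ h => h⟩
  | succ D ih =>
    rintro T (hT | ⟨g, hg, rfl⟩)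
    · obtain ⟨C, hC, h⟩ := ih T hT
      exact ⟨C, Thr_mono _ _ (by gcongr; omega) hC, h⟩
    cases D with
    | zero =>
      choose j hj using hg
      obtain ⟨C, hC, h⟩ := hX j
      refine ⟨C, Thr_mono _ _ (by omega) hC, fun x hx hT => h x hx ?_⟩
      rw [← hT]
      congr 1
      funext i
      rw [hj i]
    | succ D =>
      have inner : ∀ s : Finset (Fin (m + 1)), ∀ g : Fin (m + 1) → ((Fin n → Bool) → Bool),
          (∀ i, g i ∈ Thr m n (D + 1)) → (∀ i, i ∉ s → g i ∈ Thr m n D) →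
          ∃ C ∈ Thr (m + 1) n (e + (m + 1) * (D + 1) + s.card), ∀ x ∈ X,
            THRgate m (fun i => g i x) = false → C x = false := by
        intro s
        induction s using Finset.induction_on with
        | empty =>
          intro g _ hg
          simpa using ih (fun x => THRgate m (fun i => g i x))
            (Or.inr ⟨g, fun i => hg i (by simp), rfl⟩)
        | insert i s his ihs =>
          intro g hg hgs
          rw [Finset.card_insert_of_notMem his]
          rcases hg i with hgi | ⟨h, hh, hgi⟩
          · obtain ⟨C, hC, hC'⟩ := ihs g hg (by
              intro l hl
              by_cases hli : l = i
              · subst hli; exact hgi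
              · exact hgs l (by simp [hl, hli]))
            exact ⟨C, Thr_mono _ _ (by omega) hC, hC'⟩
          · obtain ⟨C', hC', hCz'⟩ := ih (g i) (hg i)
            have hc : ∀ c, ∃ C ∈ Thr (m + 1) n (e + (m + 1) * (D + 1) + s.card), ∀ x ∈ X,
                THRgate m (fun l => Function.update g i (h c) l x) = false → C x = false := by
              intro c
              refine ihs _ ?_ ?_
              · intro l
                by_cases hli : l = i
                · subst hli
                  simpa using Thr_mono m n (Nat.le_succ D) (hh c)
                · simpa [hli] using hg l
              · intro l hl
                by_cases hli : l = i
                · subst hli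
                  simpa using hh c
                · simpa [hli] using hgs l (by simp [hl, hli])
            choose C hC hCz using hc
            let G : Fin (m + 1 + 1) → ((Fin n → Bool) → Bool) := Fin.cons C' C
            refine ⟨fun x => THRgate (m + 1) (fun j => G j x), Or.inr ⟨G, ?_, rfl⟩, ?_⟩
            · intro j
              refine Fin.cases ?_ (fun c => ?_) j
              · exact Thr_mono _ _ (Nat.le_add_right _ _) hC'
              · exact hC c
            · intro x hx hT
              have hT0 := hT
              rw [THRgate_false_iff] at hT ⊢
              have upd : ∀ c, (h c x = true → g i x = true) → C c x = false := by
                intro c himp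
                refine hCz c x hx ?_
                rw [THRgate_false_iff]
                have aux : ∀ l, Function.update g i (h c) l x = true → g l x = true := by
                  intro l
                  by_cases hli : l = i
                  · subst hli; simpa using himp
                  · simp [hli]
                intro a b ha hb
                exact hT a b (aux a ha) (aux b hb)
              cases hv : g i x with
              | true =>
                have all0 : ∀ j, G j x = true → j = 0 := by
                  intro j
                  refine Fin.cases (fun _ => rfl) (fun c hcx => ?_) j
                  have h1 : C c x = true := hcx
                  rw [upd c (fun _ => hv)] at h1
                  cases h1
                intro a b ha hb
                rw [all0 a ha, all0 b hb]
              | false =>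
                have hC'0 : C' x = false := hCz' x hx hv
                have hh0 : THRgate m (fun c => h c x) = false := by
                  rw [← hv, hgi]
                rw [THRgate_false_iff] at hh0
                have all0 : ∀ j, G j x = true → ∃ c, j = Fin.succ c ∧ h c x = true := by
                  intro j
                  refine Fin.cases (fun h1 => ?_) (fun c hcx => ⟨c, rfl, ?_⟩) j
                  · have h2 : C' x = true := h1
                    rw [hC'0] at h2; cases h2
                  · by_contra hne
                    have h1 : C c x = true := hcx
                    rw [upd c (fun h3 => absurd h3 hne)] at h1
                    cases h1
                intro a b ha hb
                obtain ⟨c, rfl, hc⟩ := all0 a ha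
                obtain ⟨c', rfl, hc'⟩ := all0 b hb
                rw [hh0 c c' hc hc']
      obtain ⟨C, hC, h⟩ := inner Finset.univ g hg (by simp)
      refine ⟨C, Thr_mono _ _ ?_ hC, h⟩
      simp only [Finset.card_univ, Fintype.card_fin]
      apply le_of_eq
      ring

/-- One step: from `THR^{m+1}_2` to `THR^{m+2}_2`. -/
theorem step_up (m n d D : ℕ) (hn : 1 ≤ n) (f : (Fin n → Bool) → Bool)
    (π : Protocol (Fin n → Bool) (Fin n) (m + 1)) (hd : π.depth ≤ d)
    (hπ : ComputesQGame (m + 1) n f π)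
    (T : (Fin n → Bool) → Bool) (hT : T ∈ Thr m n D) (hTf : circLE T f) :
    ∃ C ∈ Thr (m + 1) n (d + (m + 1) * D), circLE C f := by
  by_cases hne : ∃ x, f x = false
  · obtain ⟨C, hC, h⟩ := transform m n d {x | f x = false} (by
      intro j
      obtain ⟨C, hC, h⟩ := protocol_formula (m + 1) n j π (fun _ => {x | f x = false})
        (fun _ => hne) (fun x hx => hπ x hx)
      refine ⟨C, Thr_mono _ _ hd hC, fun x hx hz => ?_⟩
      rw [THRgate_false_iff] at hz
      by_cases ha : ∃ a, x (j a) = true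
      · obtain ⟨a, ha⟩ := ha
        refine h a x hx (fun l hl => ?_)
        by_contra hxl
        exact hl (hz l a (by simpa using hxl) ha)
      · refine h 0 x hx (fun l _ => ?_)
        by_contra hxl
        exact ha ⟨l, by simpa using hxl⟩) D T hT
    exact ⟨C, hC, fun x hx => h x hx (hTf x hx)⟩
  · exact ⟨_, Thr_var _ _ _ ⟨0, hn⟩, fun x hx => absurd ⟨x, hx⟩ hne⟩

/-- Renaming the parties of a protocol. -/
def mapParty {X Y : Type} {k l : ℕ} (σ : Fin k → Fin l) : Protocol X Y k → Protocol X Y l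
  | .leaf y => .leaf y
  | .node i φ π₀ π₁ => .node (σ i) φ (mapParty σ π₀) (mapParty σ π₁)

theorem mapParty_depth {X Y : Type} {k l : ℕ} (σ : Fin k → Fin l) (π : Protocol X Y k) :
    (mapParty σ π).depth = π.depth := by
  induction π with
  | leaf y => rfl
  | node i φ π₀ π₁ h₀ h₁ => simp [mapParty, Protocol.depth, h₀, h₁]

theorem mapParty_out {X Y : Type} {k l : ℕ} (σ : Fin k → Fin l) (π : Protocol X Y k)
    (x : Fin l → X) : (mapParty σ π).out x = π.out (fun i => x (σ i)) := by
  induction π with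
  | leaf y => rfl
  | node i φ π₀ π₁ h₀ h₁ => simp [mapParty, Protocol.out, h₀, h₁]

theorem main_induction (k : ℕ) (hk : 1 ≤ k) :
    ∃ c : ℕ, ∀ n d : ℕ, 1 ≤ n → ∀ f : (Fin n → Bool) → Bool,
      (∃ π : Protocol (Fin n → Bool) (Fin n) k,
        π.depth ≤ d ∧ ComputesQGame k n f π) →
      ∃ C ∈ Thr k n (c * (d + 1)), circLE C f := by
  induction k, hk using Nat.le_induction with
  | base =>
    refine ⟨1, ?_⟩
    rintro n d hn f ⟨π, hd, hπ⟩
    obtain ⟨C, hC, h⟩ := step_up 0 n d 1 hn f π hd hπ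
      (fun x => THRgate 0 (fun _ => x ⟨0, hn⟩))
      (Or.inr ⟨fun _ x => x ⟨0, hn⟩, fun _ => Thr_var _ _ _ _, rfl⟩)
      (by
        intro x _
        simp only [THRgate_false_iff]
        intro a b _ _
        omega)
    exact ⟨C, Thr_mono _ _ (by omega) hC, h⟩
  | succ k hk ih =>
    obtain ⟨c, hc⟩ := ih
    refine ⟨1 + (k + 1) * c, ?_⟩
    rintro n d hn f ⟨π, hd, hπ⟩
    let σ : Fin (k + 1) → Fin k := fun i => if h : i.val < k then ⟨i.val, h⟩ else ⟨0, hk⟩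
    obtain ⟨T, hT, hTf⟩ := hc n d hn f ⟨mapParty σ π, by rw [mapParty_depth]; exact hd, by
      intro x hx i
      rw [mapParty_out]
      have := hπ (fun i => x (σ i)) (fun i => hx _) i.castSucc
      simpa [σ] using this⟩
    obtain ⟨C, hC, h⟩ := step_up k n d _ hn f π hd hπ T hT hTf
    refine ⟨C, Thr_mono _ _ ?_ hC, h⟩
    nlinarith

/-- protocols for the Q_k-game can be converted into circuits of
THR^{k+1}_2 gates and variables with constant-factor depth blowup. -/
theorem Qk_to_circuits (k : ℕ) (hk : 2 ≤ k) :
    ∃ c : ℕ, ∀ n d : ℕ, 1 ≤ n → ∀ f : (Fin n → Bool) → Bool, QkMem k n f →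
      (∃ π : Protocol (Fin n → Bool) (Fin n) k,
        π.depth ≤ d ∧ ComputesQGame k n f π) →
      ∃ C ∈ Thr k n (c * (d + 1)), circLE C f := by
  obtain ⟨c, hc⟩ := main_induction k (by omega)
  exact ⟨c, fun n d hn f _ h => hc n d hn f h⟩
end

section
/- For every k ≥ 2 there is a constant c such that the following holds for all n ≥ 1 and d ∈ ℕ. Let f : (Fin n → Bool) → Bool with f ∈ R_k. If there exists a k-party tree protocol of depth at most d computing the R_k-communication game for f, then there exists C ∈ ThrLit(k, n, c·(d+1)) with C ≤ f. (Paper's Proposition 'R_k_to_circuits': protocols for the R_k-game can be converted into circuits of THR^{k+1}_2 gates and literals with only a constant-factor depth blowup.) -/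
/-- Query function at the root (dummy at a leaf). -/
def Protocol.rootQ {X Y : Type} {k : ℕ} : Protocol X Y k → X → Bool
  | .leaf _ => fun _ => false
  | .node _ φ _ _ => φ

/-- The child selected by the answers `b` of the parties. -/
def Protocol.child {X Y : Type} {k : ℕ} : Protocol X Y k → (Fin k → Bool) → Protocol X Y k
  | .leaf y, _ => .leaf y
  | .node i _ π₀ π₁, b => if b i then π₁ else π₀

lemma Protocol.child_depth {X Y : Type} {k d : ℕ} (π : Protocol X Y k) (b : Fin k → Bool)
    (h : π.depth ≤ d + 1) : (π.child b).depth ≤ d := by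
  cases π with
  | leaf y => simp [Protocol.child, Protocol.depth]
  | node i φ p q =>
    simp only [Protocol.depth] at h
    simp only [Protocol.child]
    split_ifs <;> omega

lemma Protocol.child_out {X Y : Type} {k : ℕ} (π : Protocol X Y k) (b : Fin k → Bool)
    (x : Fin k → X) (h : ∀ i, π.rootQ (x i) = b i) : (π.child b).out x = π.out x := by
  cases π with
  | leaf y => simp [Protocol.child]
  | node i φ p q =>
    have := h i
    simp only [Protocol.rootQ] at this
    simp only [Protocol.child, Protocol.out, this]
    split_ifs <;> rfl

lemma ThrLit_mono (k n : ℕ) {a b : ℕ} (h : a ≤ b) : ThrLit k n a ⊆ ThrLit k n b := by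
  induction h with
  | refl => exact subset_rfl
  | step _ ih => exact ih.trans (fun x hx => Or.inl hx)

/-- Combination lemma: circuits for all `k`-tuples of classes give a circuit for all classes. -/
lemma combine (k n N : ℕ) {K : Type} [DecidableEq K] (Y : K → Set (Fin n → Bool))
    (S₀ : Finset K)
    (H : ∀ τ : Fin k → K, (∀ j, τ j ∈ S₀) →
      ∃ C ∈ ThrLit k n N, ∀ j, ∀ x ∈ Y (τ j), C x = false) :
    ∀ m : ℕ, ∀ S : Finset K, S ⊆ S₀ → S.Nonempty → S.card ≤ m →
      ∃ C ∈ ThrLit k n (N + m), ∀ s ∈ S, ∀ x ∈ Y s, C x = false := by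
  intro m
  induction m with
  | zero =>
    intro S _ hne hc
    have := hne.card_pos
    omega
  | succ m ih =>
    intro S hS hne hc
    by_cases hk : S.card ≤ k
    · obtain ⟨s₀, hs₀⟩ := hne
      let e := S.equivFin
      let τ : Fin k → K := fun j => if h : j.1 < S.card then (e.symm ⟨j.1, h⟩).1 else s₀
      obtain ⟨C, hC, hC'⟩ := H τ (by
        intro j
        apply hS
        simp only [τ]
        split_ifs
        · exact (e.symm _).2
        · exact hs₀)
      refine ⟨C, ThrLit_mono k n (by omega) hC, ?_⟩
      intro s hs x hx
      have hlt := (e ⟨s, hs⟩).2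
      apply hC' ⟨(e ⟨s, hs⟩).1, by omega⟩ x
      have : τ ⟨(e ⟨s, hs⟩).1, by omega⟩ = s := by
        simp [τ]
      rw [this]; exact hx
    · let e := S.equivFin
      let t : Fin (k + 1) → K := fun j => (e.symm ⟨j.1, by omega⟩).1
      have ht : ∀ j, t j ∈ S := fun j => (e.symm _).2
      have htinj : Function.Injective t := by
        intro a b hab
        have h1 := e.symm.injective (Subtype.ext hab)
        have h2 := congrArg Fin.val h1
        exact Fin.ext h2
      by_cases hk0 : S.card = 1
      · -- then k = 0
        obtain rfl : k = 0 := by omega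
        obtain ⟨C, hC, -⟩ := H (fun j => j.elim0) (fun j => j.elim0)
        refine ⟨fun x => THRgate 0 (fun _ => C x),
          ThrLit_mono 0 n (show N + 1 ≤ N + (m + 1) by omega)
            (Or.inr ⟨fun _ => C, fun _ => hC, rfl⟩), ?_⟩
        intro s _ x _
        simp only [THRgate, decide_eq_false_iff_not, not_le]
        exact lt_of_le_of_lt (Finset.card_le_univ _) (by simp)
      have hpos := hne.card_pos
      have key : ∀ j, ∃ C ∈ ThrLit k n (N + m), ∀ s ∈ S.erase (t j), ∀ x ∈ Y s, C x = false := by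
        intro j
        have hce := Finset.card_erase_of_mem (ht j)
        apply ih
        · exact (Finset.erase_subset _ _).trans hS
        · rw [← Finset.card_pos]; omega
        · omega
      choose g hg hg' using key
      refine ⟨fun x => THRgate k (fun j => g j x), Or.inr ⟨g, hg, rfl⟩, ?_⟩
      intro s hs x hx
      simp only [THRgate, decide_eq_false_iff_not, not_le, numOnes]
      rw [Nat.lt_succ_iff, Finset.card_le_one]
      have aux : ∀ a, g a x = true → t a = s := by
        intro a ha
        by_contra hne
        have := hg' a s (Finset.mem_erase.2 ⟨fun h => hne h.symm, hs⟩) x hx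
        simp [this] at ha
      intro a ha b hb
      simp only [Finset.mem_filter, Finset.mem_univ, true_and] at ha hb
      exact htinj ((aux a ha).trans (aux b hb).symm)

lemma protocol_family (k n : ℕ) (hk : 2 ≤ k) (d : ℕ) :
    ∀ (X : Fin k → Set (Fin n → Bool))
      (π : (Fin k → Fin k) → Protocol (Fin n → Bool) (Fin n × Bool) k),
      (∀ σ, (π σ).depth ≤ d) → (∀ p, (X p).Nonempty) →
      (∀ σ (x : Fin k → Fin n → Bool), (∀ i, x i ∈ X (σ i)) →
        ∀ i, x i ((π σ).out x).1 = ((π σ).out x).2) →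
      ∃ C ∈ ThrLit k n (Fintype.card (Fin k × ((Fin k → Fin k) → Bool)) * d),
        ∀ p, ∀ x ∈ X p, C x = false := by
  classical
  induction d with
  | zero =>
    intro X π hd hne hgame
    have h0 := hd id
    have hg := hgame id
    generalize π id = ρ at h0 hg
    cases ρ with
    | node i φ p q => simp [Protocol.depth] at h0
    | leaf y =>
      obtain ⟨j, b⟩ := y
      simp only [Protocol.out, id] at hg
      choose w hw using hne
      have hX : ∀ p, ∀ x ∈ X p, x j = b := by
        intro p x hx
        have := hg (Function.update w p x) (by
          intro i
          by_cases h : i = p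
          · subst h; simpa using hx
          · simpa [h] using hw i) p
        simpa using this
      cases b with
      | false => exact ⟨fun x => x j, ⟨j, Or.inl rfl⟩, hX⟩
      | true =>
        refine ⟨fun x => !(x j), ⟨j, Or.inr rfl⟩, fun p x hx => ?_⟩
        simp [hX p x hx]
  | succ d ih =>
    intro X π hd hne hgame
    let Y : Fin k × ((Fin k → Fin k) → Bool) → Set (Fin n → Bool) :=
      fun s => {x | x ∈ X s.1 ∧ ∀ σ, (π σ).rootQ x = s.2 σ}
    let S : Finset (Fin k × ((Fin k → Fin k) → Bool)) :=
      Finset.univ.filter fun s => (Y s).Nonempty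
    have hmem : ∀ p, ∀ x ∈ X p, x ∈ Y (p, fun σ => (π σ).rootQ x) :=
      fun p x hx => ⟨hx, fun _ => rfl⟩
    have hmemS : ∀ p, ∀ x ∈ X p, (p, fun σ => (π σ).rootQ x) ∈ S :=
      fun p x hx => Finset.mem_filter.2 ⟨Finset.mem_univ _, ⟨x, hmem p x hx⟩⟩
    obtain ⟨C, hC, hC'⟩ := combine k n
      (Fintype.card (Fin k × ((Fin k → Fin k) → Bool)) * d) Y S (by
        intro τ hτ
        refine ih (fun j => Y (τ j))
          (fun σ' => (π fun i => (τ (σ' i)).1).child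
            (fun i => (τ (σ' i)).2 (fun i => (τ (σ' i)).1))) ?_ ?_ ?_
        · intro σ'
          exact Protocol.child_depth _ _ (hd _)
        · intro j
          exact (Finset.mem_filter.1 (hτ j)).2
        · intro σ' x hx
          rw [Protocol.child_out _ _ x (fun i => (hx i).2 _)]
          exact hgame _ x (fun i => (hx i).1))
      (Fintype.card (Fin k × ((Fin k → Fin k) → Bool))) S subset_rfl (by
        obtain ⟨x, hx⟩ := hne ⟨0, by omega⟩
        exact ⟨_, hmemS _ x hx⟩) (Finset.card_le_univ _)
    refine ⟨C, ?_, fun p x hx => hC' _ (hmemS p x hx) x (hmem p x hx)⟩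
    rw [Nat.mul_succ]
    exact hC

/-- protocols for the R_k-game can be converted into circuits of
THR^{k+1}_2 gates and literals with constant-factor depth blowup. -/
theorem Rk_to_circuits (k : ℕ) (hk : 2 ≤ k) :
    ∃ c : ℕ, ∀ n d : ℕ, 1 ≤ n → ∀ f : (Fin n → Bool) → Bool, RkMem k n f →
      (∃ π : Protocol (Fin n → Bool) (Fin n × Bool) k,
        π.depth ≤ d ∧ ComputesRGame k n f π) →
      ∃ C ∈ ThrLit k n (c * (d + 1)), circLE C f := by
  refine ⟨Fintype.card (Fin k × ((Fin k → Fin k) → Bool)), ?_⟩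
  intro n d hn f _ ⟨π, hd, hπ⟩
  by_cases hZ : ∃ z, f z = false
  · obtain ⟨z, hz⟩ := hZ
    obtain ⟨C, hC, hC'⟩ := protocol_family k n hk d (fun _ => {x | f x = false}) (fun _ => π)
      (fun _ => hd) (fun _ => ⟨z, hz⟩) (fun _ x hx => hπ x hx)
    exact ⟨C, ThrLit_mono k n (Nat.mul_le_mul_left _ (Nat.le_succ d)) hC,
      fun x hx => hC' ⟨0, by omega⟩ x hx⟩
  · refine ⟨fun x => x ⟨0, hn⟩, ThrLit_mono k n (Nat.zero_le _) ⟨⟨0, hn⟩, Or.inl rfl⟩, ?_⟩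
    intro x hx
    exact absurd ⟨x, hx⟩ hZ
end
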